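/- arXiv:math/0005113 — 2 statements merged into one kernel-verified Lean document; each statement's English description precedes it below -/
import Mathlib

section
/- For every sequence ω in Ω̂, the spinal group G_ω has trivial center. -/
noncomputable section

open Equiv

namespace Spinal

/-- The letter `q` of the alphabet `{1,…,q}` (here `q = m + 2`). -/
def qtop (m : ℕ) : Fin (m + 2) := Fin.last (m + 1)

/-- The letter `1` of the alphabet. -/
def qone (m : ℕ) : Fin (m + 2) := 0


theorem qone_ne_qtop (m : ℕ) : qone m ≠ qtop m := by
  simp [qone, qtop, Fin.ext_iff]

/-- The action of an alphabet permutation on the first letter of a word. -/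
def rootFun (m : ℕ) (a : Equiv.Perm (Fin (m + 2))) :
    List (Fin (m + 2)) → List (Fin (m + 2))
  | [] => []
  | y :: w => a y :: w

theorem rootFun_leftInv (m : ℕ) (a : Equiv.Perm (Fin (m + 2))) (w : List (Fin (m + 2))) :
    rootFun m a.symm (rootFun m a w) = w := by
  cases w <;> simp [rootFun]

/-- The tree automorphism induced by a root permutation. -/
def rootAut (m : ℕ) (a : Equiv.Perm (Fin (m + 2))) : Equiv.Perm (List (Fin (m + 2))) where
  toFun := rootFun m a
  invFun := rootFun m a.symm
  left_inv w := rootFun_leftInv m a w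
  right_inv w := by simpa using rootFun_leftInv m a.symm w

variable {GB : Type*} [Group GB]

/-- The spinal action of `b : G_B` determined by the sequence `ω` of homomorphisms:
at the vertex `q^n 1` the next letter is moved by `ω n b` (0-indexed, so `ω 0` is the
paper's `ω₁`). -/
def spinalFun (m : ℕ) (ω : ℕ → GB →* Equiv.Perm (Fin (m + 2))) (b : GB) :
    ℕ → List (Fin (m + 2)) → List (Fin (m + 2))
  | _, [] => []
  | n, y :: w =>
    if y = qtop m then y :: spinalFun m ω b (n + 1) w
    else if y = qone m then
      y :: (match w with
            | [] => []
            | z :: w' => ω n b z :: w')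
    else y :: w

theorem spinalFun_leftInv (m : ℕ) (ω : ℕ → GB →* Equiv.Perm (Fin (m + 2)))
    (b : GB) (n : ℕ) (w : List (Fin (m + 2))) :
    spinalFun m ω b⁻¹ n (spinalFun m ω b n w) = w := by
  induction w generalizing n with
  | nil => simp [spinalFun]
  | cons y w ih =>
    by_cases h1 : y = qtop m
    · simp [spinalFun, h1, ih]
    · by_cases h2 : y = qone m
      · match w with
        | [] => simp [spinalFun, h1, h2]
        | z :: w' => simp [spinalFun, h1, h2, map_inv, qone_ne_qtop]
      · simp [spinalFun, h1, h2]

/-- The tree automorphism induced by `b : G_B` via the sequence `ω`. -/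
def spinalAut (m : ℕ) (ω : ℕ → GB →* Equiv.Perm (Fin (m + 2))) (b : GB) :
    Equiv.Perm (List (Fin (m + 2))) where
  toFun := spinalFun m ω b 0
  invFun := spinalFun m ω b⁻¹ 0
  left_inv w := spinalFun_leftInv m ω b 0 w
  right_inv w := by simpa using spinalFun_leftInv m ω b⁻¹ 0 w

/-- The canonical generating set `S_ω = A ∪ B_ω` (non-identity induced automorphisms). -/
def genSet (m : ℕ) (GA : Subgroup (Equiv.Perm (Fin (m + 2))))
    (ω : ℕ → GB →* Equiv.Perm (Fin (m + 2))) : Set (Equiv.Perm (List (Fin (m + 2)))) :=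
  ((rootAut m '' (GA : Set (Equiv.Perm (Fin (m + 2))))) ∪
    Set.range fun b : GB => spinalAut m ω b) \ {1}

/-- The spinal group `G_ω`, as a subgroup of the permutation group of the vertex set
of the `(m+2)`-regular rooted tree. -/
def spinalGroup (m : ℕ) (GA : Subgroup (Equiv.Perm (Fin (m + 2))))
    (ω : ℕ → GB →* Equiv.Perm (Fin (m + 2))) : Subgroup (Equiv.Perm (List (Fin (m + 2)))) :=
  Subgroup.closure (genSet m GA ω)

/-- The defining conditions on the data `(G_A, G_B, ω)` of a spinal group:
`G_A` is a transitive (hence faithful) group of permutations of the alphabet,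
every `ω n` is an epimorphism onto `G_A`, and `ω ∈ Ω̂`: from every index on, the kernels
of the remaining homomorphisms cover `G_B` and intersect trivially. -/
structure SpinalData (m : ℕ) (GA : Subgroup (Equiv.Perm (Fin (m + 2))))
    (ω : ℕ → GB →* Equiv.Perm (Fin (m + 2))) : Prop where
  transitive : ∀ i j : Fin (m + 2), ∃ a ∈ GA, a i = j
  range_eq : ∀ n, (ω n).range = GA
  kernels_cover : ∀ i : ℕ, ∀ b : GB, ∃ j, i ≤ j ∧ ω j b = 1
  kernels_sep : ∀ i : ℕ, ∀ b : GB, (∀ j, i ≤ j → ω j b = 1) → b = 1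

/-- Word length of a group element with respect to a set of generators. -/
def wordLength {G : Type*} [Group G] (S : Set G) (g : G) : ℕ :=
  sInf {n | ∃ l : List G, l.length = n ∧ (∀ x ∈ l, x ∈ S) ∧ l.prod = g}

/-- The word growth function `γ_ω` of the spinal group with respect to `S_ω`. -/
def growth (m : ℕ) (GA : Subgroup (Equiv.Perm (Fin (m + 2))))
    (ω : ℕ → GB →* Equiv.Perm (Fin (m + 2))) (n : ℕ) : ℕ :=
  Nat.card {g : Equiv.Perm (List (Fin (m + 2))) //
    g ∈ spinalGroup m GA ω ∧ wordLength (genSet m GA ω) g ≤ n}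

/-- The period growth function `π_ω`: the largest order of an element of word length
at most `n`. -/
def periodGrowth (m : ℕ) (GA : Subgroup (Equiv.Perm (Fin (m + 2))))
    (ω : ℕ → GB →* Equiv.Perm (Fin (m + 2))) (n : ℕ) : ℕ :=
  sSup (orderOf '' {g : Equiv.Perm (List (Fin (m + 2))) |
    g ∈ spinalGroup m GA ω ∧ wordLength (genSet m GA ω) g ≤ n})

/-- Abstract letters for words over `S_ω`: an `A`-letter is (induced by) a permutation
of the alphabet, a `B`-letter is (induced by) an element of `G_B`. -/
abbrev Letter (m : ℕ) (GB : Type*) := Equiv.Perm (Fin (m + 2)) ⊕ GB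

/-- Evaluation of an abstract letter as a tree automorphism. -/
def evalLetter (m : ℕ) (ω : ℕ → GB →* Equiv.Perm (Fin (m + 2))) :
    Letter m GB → Equiv.Perm (List (Fin (m + 2))) :=
  Sum.elim (rootAut m) (spinalAut m ω)

/-- The list of `A`-letters of a word, in order. -/
def aLetters {m : ℕ} {GB : Type*} : List (Letter m GB) → List (Equiv.Perm (Fin (m + 2))) :=
  List.filterMap fun x => match x with
    | Sum.inl a => some a
    | Sum.inr _ => none

/-- The list of `B`-letters of a word, in order. -/
def bLetters {m : ℕ} {GB : Type*} : List (Letter m GB) → List GB :=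
  List.filterMap fun x => match x with
    | Sum.inl _ => none
    | Sum.inr b => some b

/-- A word is reduced if its letters alternate between `A`-letters and `B`-letters and
no letter is the identity. -/
def IsReduced {m : ℕ} (F : List (Letter m GB)) : Prop :=
  List.Chain' (fun x y => x.isLeft ≠ y.isLeft) F ∧
    Sum.inl (1 : Equiv.Perm (Fin (m + 2))) ∉ F ∧ Sum.inr (1 : GB) ∉ F

open scoped Classical in
/-- One step of the (complete, confluent) simple reduction process: prepend a letter to an
already reduced word and reduce. -/
def reduceStep {m : ℕ} : Letter m GB → List (Letter m GB) → List (Letter m GB)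
  | Sum.inl a, [] => if a = 1 then [] else [Sum.inl a]
  | Sum.inr b, [] => if b = 1 then [] else [Sum.inr b]
  | Sum.inl a, Sum.inl a' :: t => if a * a' = 1 then t else Sum.inl (a * a') :: t
  | Sum.inr b, Sum.inr b' :: t => if b * b' = 1 then t else Sum.inr (b * b') :: t
  | Sum.inl a, y :: t => if a = 1 then y :: t else Sum.inl a :: y :: t
  | Sum.inr b, y :: t => if b = 1 then y :: t else Sum.inr b :: y :: t

/-- The reduced form of a word, obtained by simple reductions. -/
def reduceWord {m : ℕ} (F : List (Letter m GB)) : List (Letter m GB) :=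
  F.foldr reduceStep []

open scoped Classical in
/-- The (unreduced) projection of a word, representing an element of the first-level
stabilizer, to the coordinate `i` of the first level: scanning the word from the left
while accumulating the product `g` of the `A`-letters, a `B`-letter `b` contributes the
letter `b` at the coordinate `g(q)` and the letter `ω₁(b)` at the coordinate `g(1)`. -/
def projWord (m : ℕ) (ω0 : GB →* Equiv.Perm (Fin (m + 2))) (i : Fin (m + 2)) :
    List (Letter m GB) → Equiv.Perm (Fin (m + 2)) → List (Letter m GB)
  | [], _ => []
  | Sum.inl a :: F, g => projWord m ω0 i F (g * a)
  | Sum.inr b :: F, g =>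
      ((if g (qtop m) = i then [Sum.inr b] else []) ++
        (if g (qone m) = i then [Sum.inl (ω0 b)] else [])) ++ projWord m ω0 i F g

/-- The list of the `q^r` (reduced) words at level `r` of the depth-`r` decomposition
of a word. -/
def levelWords (m : ℕ) :
    (ℕ → GB →* Equiv.Perm (Fin (m + 2))) → ℕ → List (Letter m GB) →
      List (List (Letter m GB))
  | _, 0, F => [F]
  | ω, r + 1, F =>
      (List.finRange (m + 2)).flatMap fun i =>
        levelWords m (fun n => ω (n + 1)) r (reduceWord (projWord m (ω 0) i F 1))

/-- `|L_r(F)|`: the total length of level `r` of the depth-`r` decomposition of `F`. -/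
def levelLength (m : ℕ) (ω : ℕ → GB →* Equiv.Perm (Fin (m + 2))) (r : ℕ)
    (F : List (Letter m GB)) : ℕ :=
  ((levelWords m ω r F).map List.length).sum

/-- The triangular weight of a letter: `A`-letters have weight `τ₀ = 1 - η^r`; a
`B`-letter `b` has weight `τ_i = η^r + η^(r-i) - 1` where `i` is the smallest (1-based)
index with `ω_i(b) = 1`. -/
def letterWeight (m : ℕ) (ω : ℕ → GB →* Equiv.Perm (Fin (m + 2))) (η : ℝ) (r : ℕ) :
    Letter m GB → ℝ
  | Sum.inl _ => 1 - η ^ r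
  | Sum.inr b => η ^ r + η ^ (r - (sInf {j | ω j b = 1} + 1)) - 1

/-- The total triangular weight of a word. -/
def wordWeight (m : ℕ) (ω : ℕ → GB →* Equiv.Perm (Fin (m + 2))) (η : ℝ) (r : ℕ)
    (F : List (Letter m GB)) : ℝ :=
  (F.map (letterWeight m ω η r)).sum

/-- The weight `∂^τ(g)` of a group element: the least total weight of a word over `S_ω`
representing it. -/
def elemWeight (m : ℕ) (GA : Subgroup (Equiv.Perm (Fin (m + 2))))
    (ω : ℕ → GB →* Equiv.Perm (Fin (m + 2))) (η : ℝ) (r : ℕ)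
    (g : Equiv.Perm (List (Fin (m + 2)))) : ℝ :=
  sInf {x : ℝ | ∃ F : List (Letter m GB),
    (∀ a : Equiv.Perm (Fin (m + 2)), Sum.inl a ∈ F → a ∈ GA) ∧
    (F.map (evalLetter m ω)).prod = g ∧ wordWeight m ω η r F = x}

/-- A map on words is a tree map if it preserves length and commutes with truncation. -/
structure IsTreeMap {α : Type*} (f : List α → List α) : Prop where
  length_eq : ∀ w, (f w).length = w.length
  map_take : ∀ k w, f (w.take k) = (f w).take k

theorem isTreeMap_rootFun (m : ℕ) (a : Equiv.Perm (Fin (m + 2))) : IsTreeMap (rootFun m a) where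
  length_eq w := by cases w <;> simp [rootFun]
  map_take k w := by cases w <;> cases k <;> simp [rootFun]

theorem isTreeMap_spinalFun (m : ℕ) (ω : ℕ → GB →* Equiv.Perm (Fin (m + 2))) (b : GB) (n : ℕ) :
    IsTreeMap (spinalFun m ω b n) where
  length_eq w := by
    induction w generalizing n with
    | nil => simp [spinalFun]
    | cons y w ih =>
      by_cases h1 : y = qtop m
      · simp [spinalFun, h1, ih]
      · by_cases h2 : y = qone m
        · cases w <;> simp [spinalFun, h2, qone_ne_qtop]
        · simp [spinalFun, h1, h2]
  map_take k w := by
    induction w generalizing n k with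
    | nil => simp [spinalFun]
    | cons y w ih =>
      cases k with
      | zero => simp [spinalFun]
      | succ k =>
        by_cases h1 : y = qtop m
        · simp [spinalFun, h1, ih]
        · by_cases h2 : y = qone m
          · cases w <;> cases k <;> simp [spinalFun, h2, qone_ne_qtop]
          · simp [spinalFun, h1, h2]

theorem isTreeMap_of_mem_spinalGroup {m : ℕ} {GA : Subgroup (Equiv.Perm (Fin (m + 2)))}
    {ω : ℕ → GB →* Equiv.Perm (Fin (m + 2))} {g : Equiv.Perm (List (Fin (m + 2)))}
    (hg : g ∈ spinalGroup m GA ω) : IsTreeMap g := by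
  induction hg using Subgroup.closure_induction with
  | mem x hx =>
    obtain ⟨⟨a, -, rfl⟩ | ⟨b, rfl⟩, -⟩ := hx
    · exact isTreeMap_rootFun m a
    · exact isTreeMap_spinalFun m ω b 0
  | one => exact ⟨fun _ => rfl, fun _ _ => rfl⟩
  | mul x y _ _ hx hy =>
    exact ⟨fun w => by simp [hx.length_eq, hy.length_eq],
      fun k w => by simp [hx.map_take, hy.map_take]⟩
  | inv x _ hx =>
    refine ⟨fun w => ?_, fun k w => ?_⟩
    · simpa using (hx.length_eq (x⁻¹ w)).symm
    · rw [Equiv.Perm.inv_eq_iff_eq, hx.map_take]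
      simp

theorem rootAut_mem_spinalGroup {m : ℕ} {GA : Subgroup (Equiv.Perm (Fin (m + 2)))}
    (ω : ℕ → GB →* Equiv.Perm (Fin (m + 2))) {a : Equiv.Perm (Fin (m + 2))} (ha : a ∈ GA) :
    rootAut m a ∈ spinalGroup m GA ω := by
  by_cases h : rootAut m a = 1
  · exact h ▸ one_mem _
  · exact Subgroup.subset_closure ⟨Or.inl ⟨a, ha, rfl⟩, h⟩

theorem spinalAut_mem_spinalGroup {m : ℕ} (GA : Subgroup (Equiv.Perm (Fin (m + 2))))
    (ω : ℕ → GB →* Equiv.Perm (Fin (m + 2))) (b : GB) :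
    spinalAut m ω b ∈ spinalGroup m GA ω := by
  by_cases h : spinalAut m ω b = 1
  · exact h ▸ one_mem _
  · exact Subgroup.subset_closure ⟨Or.inr ⟨b, rfl⟩, h⟩

theorem spinalFun_qtop_cons (m : ℕ) (ω : ℕ → GB →* Equiv.Perm (Fin (m + 2))) (b : GB) (n : ℕ)
    (w : List (Fin (m + 2))) :
    spinalFun m ω b n (qtop m :: w) = qtop m :: spinalFun m ω b (n + 1) w := by
  simp [spinalFun]

theorem spinalFun_qone_cons (m : ℕ) (ω : ℕ → GB →* Equiv.Perm (Fin (m + 2))) (b : GB) (n : ℕ)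
    (w : List (Fin (m + 2))) :
    spinalFun m ω b n (qone m :: w) = qone m :: rootFun m (ω n b) w := by
  cases w <;> simp [spinalFun, rootFun, qone_ne_qtop]

theorem spinalFun_singleton (m : ℕ) (ω : ℕ → GB →* Equiv.Perm (Fin (m + 2))) (b : GB) (n : ℕ)
    (y : Fin (m + 2)) : spinalFun m ω b n [y] = [y] := by
  by_cases h1 : y = qtop m <;> by_cases h2 : y = qone m <;> simp [spinalFun, h1, h2]

/-- Off the subtree at `q`, a spinal map fixing a vertex of level two fixes the whole subtree
below that vertex. -/
theorem spinalFun_eq_self_of_ne_qtop {m : ℕ} {ω : ℕ → GB →* Equiv.Perm (Fin (m + 2))} {b : GB}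
    {n : ℕ} {i j : Fin (m + 2)} (hi : i ≠ qtop m) (h : spinalFun m ω b n [i, j] = [i, j])
    (t : List (Fin (m + 2))) : spinalFun m ω b n (i :: j :: t) = i :: j :: t := by
  by_cases h2 : i = qone m
  · subst h2
    simpa [spinalFun_qone_cons, rootFun] using h
  · simp [spinalFun, hi, h2]

theorem eq_one_of_spinalFun_eq_self {m : ℕ} {ω : ℕ → GB →* Equiv.Perm (Fin (m + 2))} {b : GB}
    {n : ℕ} (h : ∀ w, spinalFun m ω b n w = w) (k : ℕ) : ω (n + k) b = 1 := by
  induction k generalizing n with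
  | zero =>
    ext1 z
    simpa [spinalFun_qone_cons, rootFun] using h [qone m, z]
  | succ k ih =>
    rw [← Nat.succ_add_eq_add_succ n k]
    exact ih fun w => by simpa [spinalFun_qtop_cons] using h (qtop m :: w)

theorem SpinalData.exists_ne_one {m : ℕ} {GA : Subgroup (Equiv.Perm (Fin (m + 2)))}
    {ω : ℕ → GB →* Equiv.Perm (Fin (m + 2))} (h : SpinalData m GA ω) : ∃ b : GB, b ≠ 1 := by
  obtain ⟨a, ha, hq⟩ := h.transitive (qone m) (qtop m)
  rw [← h.range_eq 0] at ha
  obtain ⟨b, rfl⟩ := ha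
  refine ⟨b, ?_⟩
  rintro rfl
  exact qone_ne_qtop m (by simpa using hq)

/-- An injective tree map commuting with the spinal maps fixes the vertex `q`. -/
theorem SpinalData.map_qtop_eq {m : ℕ} {GA : Subgroup (Equiv.Perm (Fin (m + 2)))}
    {ω : ℕ → GB →* Equiv.Perm (Fin (m + 2))} (h : SpinalData m GA ω) {n : ℕ}
    {f : List (Fin (m + 2)) → List (Fin (m + 2))} (hinj : Function.Injective f)
    (hf : IsTreeMap f) (hB : ∀ b w, f (spinalFun m ω b n w) = spinalFun m ω b n (f w)) :
    f [qtop m] = [qtop m] := by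
  obtain ⟨i, hi⟩ := List.length_eq_one_iff.1 (hf.length_eq [qtop m])
  by_contra hne
  have hiq : i ≠ qtop m := fun e => hne (by rw [hi, e])
  obtain ⟨b, hb⟩ := h.exists_ne_one
  refine hb (h.kernels_sep (n + 1) b fun j hj => ?_)
  obtain ⟨k, rfl⟩ := Nat.exists_eq_add_of_le hj
  refine eq_one_of_spinalFun_eq_self (fun w => ?_) k
  rcases w with _ | ⟨y, w⟩
  · simp [spinalFun]
  have h1 : (f (qtop m :: y :: w)).take 1 = [i] := by rw [← hi, ← hf.map_take]; rfl
  have h2 : (f (qtop m :: y :: w)).take 2 = f [qtop m, y] := by rw [← hf.map_take]; rfl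
  have hlen := hf.length_eq (qtop m :: y :: w)
  have hfix := hB b [qtop m, y]
  rw [spinalFun_qtop_cons, spinalFun_singleton] at hfix
  have key := hB b (qtop m :: y :: w)
  generalize hv : f (qtop m :: y :: w) = v at h1 h2 hlen key
  match v, hlen with
  | i' :: j :: t, _ =>
    obtain rfl : i' = i := by simpa using h1
    rw [← h2] at hfix
    rw [spinalFun_eq_self_of_ne_qtop hiq (by simpa using hfix.symm), ← hv] at key
    simpa [spinalFun_qtop_cons] using hinj key

/-- An injective tree map commuting with the root group and the spinal maps is trivial. -/
theorem SpinalData.eq_self_of_commute {m : ℕ} {GA : Subgroup (Equiv.Perm (Fin (m + 2)))}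
    {ω : ℕ → GB →* Equiv.Perm (Fin (m + 2))} (h : SpinalData m GA ω) {n : ℕ}
    {f : List (Fin (m + 2)) → List (Fin (m + 2))} (hinj : Function.Injective f)
    (hf : IsTreeMap f) (hA : ∀ a ∈ GA, ∀ w, f (rootFun m a w) = rootFun m a (f w))
    (hB : ∀ b w, f (spinalFun m ω b n w) = spinalFun m ω b n (f w))
    (w : List (Fin (m + 2))) : f w = w := by
  induction w generalizing n f with
  | nil => simpa using hf.length_eq []
  | cons y w ih =>
    set g : List (Fin (m + 2)) → List (Fin (m + 2)) := fun w => (f (qtop m :: w)).tail with hg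
    have hq (w) : f (qtop m :: w) = qtop m :: g w := by
      have h1 : (f (qtop m :: w)).take 1 = [qtop m] := by
        rw [← h.map_qtop_eq hinj hf hB, ← hf.map_take]; rfl
      rw [← List.take_append_drop 1 (f (qtop m :: w)), h1, hg]
      simp
    have hcons (y w) : f (y :: w) = y :: g w := by
      obtain ⟨a, ha, rfl⟩ := h.transitive (qtop m) y
      simpa [hq, rootFun] using hA a ha (qtop m :: w)
    rw [hcons]
    congr 1
    refine ih (n := n + 1) (fun u v huv => ?_) ⟨fun w => ?_, fun k w => ?_⟩
      (fun a ha w => ?_) (fun b w => ?_)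
    · have : f (qtop m :: u) = f (qtop m :: v) := by rw [hq, hq, huv]
      simpa using hinj this
    · simpa [hq] using hf.length_eq (qtop m :: w)
    · simpa [hq] using hf.map_take (k + 1) (qtop m :: w)
    · rw [← h.range_eq n] at ha
      obtain ⟨b, rfl⟩ := ha
      simpa [hcons, spinalFun_qone_cons] using hB b (qone m :: w)
    · simpa [hcons, spinalFun_qtop_cons] using hB b (qtop m :: w)

/-- For every sequence `ω` in `Ω̂`, the spinal group `G_ω` has trivial center. -/
theorem spinalGroup_center_trivial (m : ℕ) (GA : Subgroup (Equiv.Perm (Fin (m + 2))))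
    {GB : Type*} [Group GB] [Finite GB] (ω : ℕ → GB →* Equiv.Perm (Fin (m + 2)))
    (hdata : SpinalData m GA ω) :
    Subgroup.center ↥(spinalGroup m GA ω) = ⊥ := by
  rw [Subgroup.eq_bot_iff_forall]
  rintro ⟨z, hz⟩ hc
  rw [Subgroup.mem_center_iff] at hc
  have hcomm (g) (hg : g ∈ spinalGroup m GA ω) (w) : z (g w) = g (z w) :=
    (DFunLike.congr_fun (congrArg Subtype.val (hc ⟨g, hg⟩)) w).symm
  ext1
  ext1 w
  exact hdata.eq_self_of_commute (n := 0) z.injective (isTreeMap_of_mem_spinalGroup hz)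
    (fun a ha => hcomm _ (rootAut_mem_spinalGroup ω ha))
    (fun b => hcomm _ (spinalAut_mem_spinalGroup GA ω b)) w
end Spinal
end
end

section
/- For every ω ∈ Ω̂, the spinal group G_ω has subexponential word growth: limsup_{n→∞} γ_ω(n)^{1/n} = 1. -/
noncomputable section

open Equiv

namespace Spinal

variable {GB : Type*} [Group GB]

/-! ### Wreath recursion for the generators -/

theorem rootAut_mul (m : ℕ) (a a' : Equiv.Perm (Fin (m + 2))) :
    rootAut m (a * a') = rootAut m a * rootAut m a' := by
  ext1 w
  cases w <;> rfl

theorem rootAut_one (m : ℕ) : rootAut m 1 = 1 := by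
  ext1 w
  cases w <;> rfl

theorem rootAut_inv (m : ℕ) (a : Equiv.Perm (Fin (m + 2))) :
    rootAut m a⁻¹ = (rootAut m a)⁻¹ := by
  rw [eq_inv_iff_mul_eq_one, ← rootAut_mul, inv_mul_cancel, rootAut_one]

theorem spinalFun_mul (m : ℕ) (ω : ℕ → GB →* Equiv.Perm (Fin (m + 2))) (b b' : GB) (n : ℕ)
    (w : List (Fin (m + 2))) :
    spinalFun m ω (b * b') n w = spinalFun m ω b n (spinalFun m ω b' n w) := by
  induction w generalizing n with
  | nil => simp [spinalFun]
  | cons y w ih =>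
    by_cases h1 : y = qtop m
    · simp [spinalFun, h1, ih]
    · by_cases h2 : y = qone m
      · match w with
        | [] => simp [spinalFun, h2]
        | z :: w' => simp [spinalFun, h2, qone_ne_qtop]
      · simp [spinalFun, h1, h2]

theorem spinalAut_mul (m : ℕ) (ω : ℕ → GB →* Equiv.Perm (Fin (m + 2))) (b b' : GB) :
    spinalAut m ω (b * b') = spinalAut m ω b * spinalAut m ω b' := by
  ext1 w
  exact spinalFun_mul m ω b b' 0 w

theorem spinalAut_one (m : ℕ) (ω : ℕ → GB →* Equiv.Perm (Fin (m + 2))) :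
    spinalAut m ω 1 = 1 := by
  have h := spinalAut_mul m ω 1 1
  rwa [mul_one, left_eq_mul] at h

theorem spinalAut_inv (m : ℕ) (ω : ℕ → GB →* Equiv.Perm (Fin (m + 2))) (b : GB) :
    spinalAut m ω b⁻¹ = (spinalAut m ω b)⁻¹ := by
  rw [eq_inv_iff_mul_eq_one, ← spinalAut_mul, inv_mul_cancel, spinalAut_one]

theorem spinalFun_shift (m : ℕ) (ω : ℕ → GB →* Equiv.Perm (Fin (m + 2))) (b : GB) (n : ℕ)
    (w : List (Fin (m + 2))) :
    spinalFun m (fun k => ω (k + 1)) b n w = spinalFun m ω b (n + 1) w := by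
  induction w generalizing n with
  | nil => simp [spinalFun]
  | cons y w ih =>
    by_cases h1 : y = qtop m
    · simp [spinalFun, h1, ih]
    · by_cases h2 : y = qone m
      · match w with
        | [] => simp [spinalFun, h2]
        | z :: w' => simp [spinalFun, h2, qone_ne_qtop]
      · simp [spinalFun, h1, h2]

theorem spinalAut_cons_qtop (m : ℕ) (ω : ℕ → GB →* Equiv.Perm (Fin (m + 2))) (b : GB)
    (w : List (Fin (m + 2))) :
    spinalAut m ω b (qtop m :: w) = qtop m :: spinalAut m (fun k => ω (k + 1)) b w := by
  change spinalFun m ω b 0 (qtop m :: w) = qtop m :: spinalFun m (fun k => ω (k + 1)) b 0 w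
  simp [spinalFun, spinalFun_shift]

theorem spinalAut_cons_qone (m : ℕ) (ω : ℕ → GB →* Equiv.Perm (Fin (m + 2))) (b : GB)
    (w : List (Fin (m + 2))) :
    spinalAut m ω b (qone m :: w) = qone m :: rootAut m (ω 0 b) w := by
  change spinalFun m ω b 0 (qone m :: w) = qone m :: rootFun m (ω 0 b) w
  cases w <;> simp [spinalFun, qone_ne_qtop, rootFun]

theorem spinalAut_cons_of_ne (m : ℕ) (ω : ℕ → GB →* Equiv.Perm (Fin (m + 2))) (b : GB)
    {y : Fin (m + 2)} (h1 : y ≠ qtop m) (h2 : y ≠ qone m) (w : List (Fin (m + 2))) :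
    spinalAut m ω b (y :: w) = y :: w := by
  change spinalFun m ω b 0 (y :: w) = y :: w
  simp [spinalFun, h1, h2]

/-! ### Weighted lengths -/

/-- `WeightLE m GA ω p n g` says that `g` is the product of a word over `A ∪ B_ω` whose total
weight is at most `n`, where `A`-letters are free and the letter of `b : GB` costs `p b`. -/
inductive WeightLE (m : ℕ) (GA : Subgroup (Equiv.Perm (Fin (m + 2))))
    (ω : ℕ → GB →* Equiv.Perm (Fin (m + 2))) (p : GB → ℕ) :
    ℕ → Equiv.Perm (List (Fin (m + 2))) → Prop
  | one (n : ℕ) : WeightLE m GA ω p n 1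
  | mul_root {n : ℕ} {g : Equiv.Perm (List (Fin (m + 2)))} {a : Equiv.Perm (Fin (m + 2))} :
      WeightLE m GA ω p n g → a ∈ GA → WeightLE m GA ω p n (g * rootAut m a)
  | mul_spinal {n : ℕ} {g : Equiv.Perm (List (Fin (m + 2)))} (b : GB) :
      WeightLE m GA ω p n g → WeightLE m GA ω p (n + p b) (g * spinalAut m ω b)

namespace WeightLE

variable {m : ℕ} {GA : Subgroup (Equiv.Perm (Fin (m + 2)))}
  {ω : ℕ → GB →* Equiv.Perm (Fin (m + 2))} {p p' : GB → ℕ} {n n' : ℕ}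
  {g : Equiv.Perm (List (Fin (m + 2)))}

theorem mono (h : WeightLE m GA ω p n g) (hn : n ≤ n') : WeightLE m GA ω p n' g := by
  induction h generalizing n' with
  | one => exact one _
  | mul_root _ ha ih => exact (ih hn).mul_root ha
  | @mul_spinal k g b _ ih =>
    have := (ih (n' := n' - p b) (by omega)).mul_spinal b
    rwa [Nat.sub_add_cancel (by omega)] at this

theorem const_mul (c : ℕ) (h : WeightLE m GA ω (fun _ => 1) n g) :
    WeightLE m GA ω (fun _ => c) (c * n) g := by
  induction h with
  | one => exact one _
  | mul_root _ ha ih => exact ih.mul_root ha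
  | mul_spinal b _ ih => exact ih.mul_spinal b

theorem div_const {c : ℕ} (hc : 0 < c) (h : WeightLE m GA ω (fun _ => c) n g) :
    WeightLE m GA ω (fun _ => 1) (n / c) g := by
  induction h with
  | one => exact one _
  | mul_root _ ha ih => exact ih.mul_root ha
  | mul_spinal b _ ih => simpa [Nat.add_div_right _ hc] using ih.mul_spinal b

theorem to_unit (hp : ∀ b, 1 ≤ p b) (h : WeightLE m GA ω p n g) :
    WeightLE m GA ω (fun _ => 1) n g := by
  induction h with
  | one => exact one _
  | mul_root _ ha ih => exact ih.mul_root ha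
  | mul_spinal b _ ih => exact (ih.mul_spinal b).mono (Nat.add_le_add_left (hp b) _)

end WeightLE

/-- A bookkeeping variant of `WeightLE`: the last block of `B`-letters may still be open, in which
case its cost is reduced by one. -/
def OpenWeightLE (m : ℕ) (GA : Subgroup (Equiv.Perm (Fin (m + 2))))
    (ω : ℕ → GB →* Equiv.Perm (Fin (m + 2))) (p : GB → ℕ) (n : ℕ)
    (g : Equiv.Perm (List (Fin (m + 2)))) : Prop :=
  WeightLE m GA ω p n g ∨
    ∃ (k : ℕ) (h : Equiv.Perm (List (Fin (m + 2)))) (b : GB),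
      WeightLE m GA ω p k h ∧ g = h * spinalAut m ω b ∧ k + p b ≤ n + 1

namespace OpenWeightLE

variable {m : ℕ} {GA : Subgroup (Equiv.Perm (Fin (m + 2)))}
  {ω : ℕ → GB →* Equiv.Perm (Fin (m + 2))} {p : GB → ℕ} {n : ℕ}
  {g : Equiv.Perm (List (Fin (m + 2)))}

theorem weightLE (h : OpenWeightLE m GA ω p n g) : WeightLE m GA ω p (n + 1) g := by
  rcases h with h | ⟨k, h, b, hk, rfl, hle⟩
  · exact h.mono n.le_succ
  · exact (hk.mul_spinal b).mono hle

theorem mul_root (h : OpenWeightLE m GA ω p n g) {a : Equiv.Perm (Fin (m + 2))} (ha : a ∈ GA) :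
    OpenWeightLE m GA ω p (n + if a = 1 then 0 else 1) (g * rootAut m a) := by
  split_ifs with h1
  · simpa [h1, rootAut_one] using h
  · exact Or.inl (h.weightLE.mul_root ha)

theorem mul_spinal (hp2 : ∀ b, 2 ≤ p b) (hp3 : ∀ b, p b ≤ 3) (h : OpenWeightLE m GA ω p n g)
    (b : GB) : OpenWeightLE m GA ω p (n + (p b - 1)) (g * spinalAut m ω b) := by
  have hb := hp2 b
  rcases h with h | ⟨k, h, b', hk, rfl, hle⟩
  · exact Or.inr ⟨n, g, b, h, rfl, by omega⟩
  · refine Or.inr ⟨k, h, b' * b, hk, by rw [spinalAut_mul, mul_assoc], ?_⟩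
    have := hp2 b'
    have := hp3 (b' * b)
    omega

end OpenWeightLE

/-- Passing to the first level of the tree increases the total weight by at most the number of
coordinates, provided that only letters killed by `ω 0` become more expensive. -/
theorem WeightLE.exists_sections {m : ℕ} {GA : Subgroup (Equiv.Perm (Fin (m + 2)))}
    {ω : ℕ → GB →* Equiv.Perm (Fin (m + 2))} {p p' : GB → ℕ} {n : ℕ}
    {g : Equiv.Perm (List (Fin (m + 2)))} (hω : ∀ b, ω 0 b ∈ GA) (hp : ∀ b, 2 ≤ p b)
    (hp2 : ∀ b, 2 ≤ p' b) (hp3 : ∀ b, p' b ≤ 3) (hpp : ∀ b, ω 0 b = 1 ∨ p' b ≤ p b)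
    (h : WeightLE m GA ω p n g) :
    ∃ σ ∈ GA, ∃ (s : Fin (m + 2) → Equiv.Perm (List (Fin (m + 2)))) (k : Fin (m + 2) → ℕ),
      g [] = [] ∧ (∀ y w, g (y :: w) = σ y :: s y w) ∧
      (∀ y, OpenWeightLE m GA (fun j => ω (j + 1)) p' (k y) (s y)) ∧ ∑ y, k y ≤ n := by
  induction h with
  | one n =>
    exact ⟨1, GA.one_mem, 1, 0, rfl, fun _ _ => rfl, fun _ => Or.inl (.one _), by simp⟩
  | @mul_root n g a _ ha ih =>
    obtain ⟨σ, hσ, s, k, hnil, hcons, hs, hk⟩ := ih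
    refine ⟨σ * a, GA.mul_mem hσ ha, s ∘ a, k ∘ a, hnil, fun y w => hcons (a y) w,
      fun y => hs (a y), ?_⟩
    rwa [← Equiv.sum_comp a k] at hk
  | @mul_spinal n g b _ ih =>
    obtain ⟨σ, hσ, s, k, hnil, hcons, hs, hk⟩ := ih
    refine ⟨σ, hσ,
      fun y => if y = qtop m then s y * spinalAut m (fun j => ω (j + 1)) b
        else if y = qone m then s y * rootAut m (ω 0 b) else s y,
      fun y => k y + ((if y = qtop m then p' b - 1 else 0) +
        if y = qone m then (if ω 0 b = 1 then 0 else 1) else 0), hnil, ?_, ?_, ?_⟩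
    · intro y w
      rw [Equiv.Perm.mul_apply]
      by_cases h1 : y = qtop m
      · subst h1
        rw [spinalAut_cons_qtop, hcons]
        simp
      · by_cases h2 : y = qone m
        · subst h2
          rw [spinalAut_cons_qone, hcons]
          simp [qone_ne_qtop]
        · rw [spinalAut_cons_of_ne m ω b h1 h2, hcons]
          simp [h1, h2]
    · intro y
      by_cases h1 : y = qtop m
      · subst h1
        simpa [(qone_ne_qtop m).symm] using (hs (qtop m)).mul_spinal hp2 hp3 b
      · by_cases h2 : y = qone m
        · subst h2
          simpa [qone_ne_qtop] using (hs (qone m)).mul_root (hω b)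
        · simpa [h1, h2] using hs y
    · rw [Finset.sum_add_distrib, Finset.sum_add_distrib, Finset.sum_ite_eq' Finset.univ (qtop m),
        Finset.sum_ite_eq' Finset.univ (qone m)]
      have := hp b
      have := hp2 b
      have := hp3 b
      simp only [Finset.mem_univ, if_true]
      split_ifs with h1
      · omega
      · have := (hpp b).resolve_left h1
        omega

/-! ### Counting -/

section Counting

open Filter Topology

variable [Finite GB]

/-- The number of elements expressible with at most `n` letters from `B_ω` grows at most
geometrically, uniformly in `ω`. -/
theorem exists_finset_of_weightLE_one (m : ℕ) (GA : Subgroup (Equiv.Perm (Fin (m + 2))))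
    (ω : ℕ → GB →* Equiv.Perm (Fin (m + 2))) (n : ℕ) :
    ∃ F : Finset (Equiv.Perm (List (Fin (m + 2)))),
      F.card ≤ Nat.card GA * (Nat.card GB * Nat.card GA) ^ n ∧
      ∀ g, WeightLE m GA ω (fun _ => 1) n g → g ∈ F := by
  classical
  have := Fintype.ofFinite GB
  have := Fintype.ofFinite GA
  let R : Finset (Equiv.Perm (List (Fin (m + 2)))) :=
    Finset.univ.image fun a : GA => rootAut m a
  let S : Finset (Equiv.Perm (List (Fin (m + 2)))) :=
    Finset.univ.image fun b : GB => spinalAut m ω b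
  have hR : R.card ≤ Nat.card GA := by
    rw [Nat.card_eq_fintype_card]
    exact Finset.card_image_le
  have hS : S.card ≤ Nat.card GB := by
    rw [Nat.card_eq_fintype_card]
    exact Finset.card_image_le
  have memR {a : Equiv.Perm (Fin (m + 2))} (ha : a ∈ GA) : rootAut m a ∈ R :=
    Finset.mem_image.2 ⟨⟨a, ha⟩, Finset.mem_univ _, rfl⟩
  have memS (b : GB) : spinalAut m ω b ∈ S := Finset.mem_image_of_mem _ (Finset.mem_univ b)
  have mulR {g : Equiv.Perm (List (Fin (m + 2)))} {a : Equiv.Perm (Fin (m + 2))} (hg : g ∈ R)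
      (ha : a ∈ GA) : g * rootAut m a ∈ R := by
    obtain ⟨a', -, rfl⟩ := Finset.mem_image.1 hg
    rw [← rootAut_mul]
    exact memR (GA.mul_mem a'.2 ha)
  let T : ℕ → Finset (Equiv.Perm (List (Fin (m + 2)))) := fun n =>
    n.rec R fun _ F => F.image₂ (· * ·) (S.image₂ (· * ·) R)
  have hT (k) : T (k + 1) = (T k).image₂ (· * ·) (S.image₂ (· * ·) R) := rfl
  have card_T (k) : (T k).card ≤ Nat.card GA * (Nat.card GB * Nat.card GA) ^ k := by
    induction k with
    | zero => simpa [T] using hR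
    | succ k ih =>
      rw [hT, pow_succ, ← mul_assoc]
      refine (Finset.card_image₂_le _ _ _).trans (Nat.mul_le_mul ih ?_)
      exact (Finset.card_image₂_le _ _ _).trans (Nat.mul_le_mul hS hR)
  have one_T (k) : 1 ∈ T k := by
    have h1 : (1 : Equiv.Perm (List (Fin (m + 2)))) ∈ R := by
      simpa [rootAut_one] using memR GA.one_mem
    induction k with
    | zero => exact h1
    | succ k ih =>
      refine Finset.mem_image₂.2 ⟨1, ih, 1, Finset.mem_image₂.2 ⟨1, ?_, 1, h1, ?_⟩, ?_⟩
      · simpa [spinalAut_one] using memS 1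
      all_goals simp
  have mulR_T (k) {g : Equiv.Perm (List (Fin (m + 2)))} {a : Equiv.Perm (Fin (m + 2))}
      (hg : g ∈ T k) (ha : a ∈ GA) : g * rootAut m a ∈ T k := by
    cases k with
    | zero => exact mulR hg ha
    | succ k =>
      obtain ⟨x, hx, y, hy, rfl⟩ := Finset.mem_image₂.1 hg
      obtain ⟨z, hz, t, ht, rfl⟩ := Finset.mem_image₂.1 hy
      exact Finset.mem_image₂.2
        ⟨x, hx, z * (t * rootAut m a), Finset.mem_image₂_of_mem hz (mulR ht ha), by group⟩
  refine ⟨T n, card_T n, fun g hg => ?_⟩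
  induction hg with
  | one => exact one_T _
  | mul_root _ ha ih => exact mulR_T _ ih ha
  | mul_spinal b _ ih =>
    refine Finset.mem_image₂.2 ⟨_, ih, _, Finset.mem_image₂_of_mem (memS b) (memR GA.one_mem), ?_⟩
    simp [rootAut_one]

theorem finite_weightLE {m : ℕ} (GA : Subgroup (Equiv.Perm (Fin (m + 2))))
    (ω : ℕ → GB →* Equiv.Perm (Fin (m + 2))) {p : GB → ℕ} (hp : ∀ b, 1 ≤ p b) (n : ℕ) :
    {g | WeightLE m GA ω p n g}.Finite := by
  obtain ⟨F, -, hF⟩ := exists_finset_of_weightLE_one m GA ω n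
  exact F.finite_toSet.subset fun g hg => hF g (WeightLE.to_unit hp hg)

/-- The number of elements of `p`-weight at most `n` grows with exponential rate at most `x`. -/
def HasRate (m : ℕ) (GA : Subgroup (Equiv.Perm (Fin (m + 2))))
    (ω : ℕ → GB →* Equiv.Perm (Fin (m + 2))) (p : GB → ℕ) (x : ℝ) : Prop :=
  ∀ y, x < y → ∃ C : ℝ, 0 ≤ C ∧ ∀ n : ℕ, ({g | WeightLE m GA ω p n g}.ncard : ℝ) ≤ C * y ^ n

theorem hasRate_one_card (m : ℕ) (GA : Subgroup (Equiv.Perm (Fin (m + 2))))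
    (ω : ℕ → GB →* Equiv.Perm (Fin (m + 2))) :
    HasRate m GA ω (fun _ => 1) (Nat.card GB * Nat.card GA) := by
  intro y hy
  refine ⟨Nat.card GA, by positivity, fun n => ?_⟩
  obtain ⟨F, hcard, hF⟩ := exists_finset_of_weightLE_one m GA ω n
  have h1 : {g | WeightLE m GA ω (fun _ => 1) n g}.ncard ≤ F.card := by
    rw [← Set.ncard_coe_finset]
    exact Set.ncard_le_ncard hF F.finite_toSet
  calc ({g | WeightLE m GA ω (fun _ => 1) n g}.ncard : ℝ)
      ≤ Nat.card GA * (Nat.card GB * Nat.card GA : ℝ) ^ n := by exact_mod_cast h1.trans hcard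
    _ ≤ _ := by gcongr

theorem HasRate.of_unit {m : ℕ} {GA : Subgroup (Equiv.Perm (Fin (m + 2)))}
    {ω : ℕ → GB →* Equiv.Perm (Fin (m + 2))} {c : ℕ} (hc : 0 < c) {x : ℝ} (hx : 1 ≤ x)
    (h : HasRate m GA ω (fun _ => 1) (x ^ c)) : HasRate m GA ω (fun _ => c) x := by
  intro y hy
  obtain ⟨C, hC, hn⟩ := h (y ^ c) (pow_lt_pow_left₀ hy (by linarith) hc.ne')
  refine ⟨C, hC, fun n => ?_⟩
  have h1 : {g | WeightLE m GA ω (fun _ => c) n g}.ncard ≤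
      {g | WeightLE m GA ω (fun _ => 1) (n / c) g}.ncard :=
    Set.ncard_le_ncard (fun g hg => WeightLE.div_const hc hg)
      (finite_weightLE GA ω (fun _ => le_rfl) _)
  calc ({g | WeightLE m GA ω (fun _ => c) n g}.ncard : ℝ)
      ≤ C * (y ^ c) ^ (n / c) := (Nat.cast_le.2 h1).trans (hn _)
    _ ≤ C * y ^ n := by
      rw [← pow_mul]
      gcongr
      · linarith
      · exact Nat.mul_div_le n c

theorem HasRate.to_unit {m : ℕ} {GA : Subgroup (Equiv.Perm (Fin (m + 2)))}
    {ω : ℕ → GB →* Equiv.Perm (Fin (m + 2))} {c : ℕ} (hc : 0 < c) {x : ℝ} (hx : 0 ≤ x)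
    (h : HasRate m GA ω (fun _ => c) x) : HasRate m GA ω (fun _ => 1) (x ^ c) := by
  intro y hy
  have hy0 : 0 ≤ y := (pow_nonneg hx c).trans hy.le
  have hroot : (y ^ (c : ℝ)⁻¹) ^ c = y := Real.rpow_inv_natCast_pow hy0 hc.ne'
  obtain ⟨C, hC, hn⟩ := h (y ^ (c : ℝ)⁻¹)
    (lt_of_pow_lt_pow_left₀ c (Real.rpow_nonneg hy0 _) (by rwa [hroot]))
  refine ⟨C, hC, fun n => ?_⟩
  have h1 : {g | WeightLE m GA ω (fun _ => 1) n g}.ncard ≤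
      {g | WeightLE m GA ω (fun _ => c) (c * n) g}.ncard :=
    Set.ncard_le_ncard (fun g hg => WeightLE.const_mul c hg) (finite_weightLE GA ω (fun _ => hc) _)
  have h2 := (Nat.cast_le.2 h1).trans (hn (c * n))
  rwa [pow_mul, hroot] at h2

/-- Number of elements of bounded weight in terms of the weights of the sections. -/
theorem ncard_weightLE_le_sum {m : ℕ} {GA : Subgroup (Equiv.Perm (Fin (m + 2)))}
    {ω : ℕ → GB →* Equiv.Perm (Fin (m + 2))} {p p' : GB → ℕ} (hω : ∀ b, ω 0 b ∈ GA)
    (hp : ∀ b, 2 ≤ p b) (hp2 : ∀ b, 2 ≤ p' b) (hp3 : ∀ b, p' b ≤ 3)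
    (hpp : ∀ b, ω 0 b = 1 ∨ p' b ≤ p b) (n : ℕ) :
    {g | WeightLE m GA ω p n g}.ncard ≤ Nat.card GA *
      ∑ k ∈ (Fintype.piFinset fun _ : Fin (m + 2) => Finset.range (n + (m + 2) + 1)).filter
        (fun k => ∑ y, k y ≤ n + (m + 2)),
        ∏ y, {g | WeightLE m GA (fun j => ω (j + 1)) p' (k y) g}.ncard := by
  classical
  have := Fintype.ofFinite GA
  have hfin := finite_weightLE GA (fun j => ω (j + 1)) (p := p') (fun b => by have := hp2 b; omega)
  have key (g) (hg : WeightLE m GA ω p n g) :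
      ∃ c : GA × (Σ _ : Fin (m + 2) → ℕ, Fin (m + 2) → Equiv.Perm (List (Fin (m + 2)))),
        g [] = [] ∧ (∀ y w, g (y :: w) = c.1.1 y :: c.2.2 y w) ∧
        c.2.1 ∈ (Fintype.piFinset fun _ : Fin (m + 2) => Finset.range (n + (m + 2) + 1)).filter
          (fun k => ∑ y, k y ≤ n + (m + 2)) ∧
        ∀ y, WeightLE m GA (fun j => ω (j + 1)) p' (c.2.1 y) (c.2.2 y) := by
    obtain ⟨σ, hσ, s, k, hnil, hcons, hs, hk⟩ := hg.exists_sections hω hp hp2 hp3 hpp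
    have hsum : ∑ y, (k y + 1) ≤ n + (m + 2) := by simpa [Finset.sum_add_distrib] using hk
    refine ⟨⟨⟨σ, hσ⟩, fun y => k y + 1, s⟩, hnil, hcons, ?_, fun y => (hs y).weightLE⟩
    simp only [Finset.mem_filter, Fintype.mem_piFinset, Finset.mem_range]
    refine ⟨fun y => ?_, hsum⟩
    have := Finset.single_le_sum (f := fun y => k y + 1) (fun _ _ => Nat.zero_le _)
      (Finset.mem_univ y)
    change k y + 1 ≤ _ at this
    omega
  choose! c hnil hcons hk hs using key
  let D : Finset (GA × (Σ _ : Fin (m + 2) → ℕ, Fin (m + 2) → Equiv.Perm (List (Fin (m + 2))))) :=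
    Finset.univ ×ˢ ((Fintype.piFinset fun _ : Fin (m + 2) =>
      Finset.range (n + (m + 2) + 1)).filter (fun k => ∑ y, k y ≤ n + (m + 2))).sigma
        fun k => Fintype.piFinset fun y => (hfin (k y)).toFinset
  have hD : D.card = Nat.card GA *
      ∑ k ∈ (Fintype.piFinset fun _ : Fin (m + 2) => Finset.range (n + (m + 2) + 1)).filter
        (fun k => ∑ y, k y ≤ n + (m + 2)),
        ∏ y, {g | WeightLE m GA (fun j => ω (j + 1)) p' (k y) g}.ncard := by
    simp only [D, Finset.card_product, Finset.card_sigma, Fintype.card_piFinset,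
      Finset.card_univ, Nat.card_eq_fintype_card, Set.ncard_eq_toFinset_card _ (hfin _)]
  rw [← hD, ← Set.ncard_coe_finset]
  refine Set.ncard_le_ncard_of_injOn c (fun g hg => ?_) (fun g hg g' hg' hc => ?_) D.finite_toSet
  · simp only [D, Finset.coe_product, Finset.coe_univ, Set.mem_prod, Set.mem_univ, true_and,
      Finset.mem_coe, Finset.mem_sigma, Fintype.mem_piFinset, Set.Finite.mem_toFinset]
    exact ⟨hk g hg, hs g hg⟩
  · ext1 w
    cases w with
    | nil => rw [hnil g hg, hnil g' hg']
    | cons y w => rw [hcons g hg, hcons g' hg', hc]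

/-- Exponential rates pass from the first level of the tree to the root. -/
theorem HasRate.of_shift {m : ℕ} {GA : Subgroup (Equiv.Perm (Fin (m + 2)))}
    {ω : ℕ → GB →* Equiv.Perm (Fin (m + 2))} {p p' : GB → ℕ} {x : ℝ} (hx : 1 ≤ x)
    (hω : ∀ b, ω 0 b ∈ GA) (hp : ∀ b, 2 ≤ p b) (hp2 : ∀ b, 2 ≤ p' b) (hp3 : ∀ b, p' b ≤ 3)
    (hpp : ∀ b, ω 0 b = 1 ∨ p' b ≤ p b)
    (h : HasRate m GA (fun j => ω (j + 1)) p' x) : HasRate m GA ω p x := by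
  intro z hz
  obtain ⟨y, hxy, hyz⟩ := exists_between hz
  have hy1 : 1 ≤ y := hx.trans hxy.le
  have hy0 : 0 ≤ y := by linarith
  have hz0 : 0 < z := by linarith
  obtain ⟨C, hC, hcount⟩ := h y hxy
  have hr : |y / z| < 1 := by
    rw [abs_of_nonneg (by positivity)]
    exact (div_lt_one hz0).2 hyz
  obtain ⟨K, hK⟩ := (tendsto_pow_const_mul_const_pow_of_abs_lt_one (m + 2) hr).bddAbove_range
  have hK' (N : ℕ) : (N : ℝ) ^ (m + 2) * y ^ N ≤ K * z ^ N := by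
    have := hK ⟨N, rfl⟩
    simp only [div_pow, ← mul_div_assoc] at this
    exact (div_le_iff₀ (by positivity)).1 this
  have hK0 : 0 ≤ K := by
    have := hK' 0
    simpa using this
  refine ⟨Nat.card GA * (C ^ (m + 2) * (K * z ^ (m + 2 + 1))), by positivity, fun n => ?_⟩
  have hterm (k : Fin (m + 2) → ℕ) (hk : ∑ i, k i ≤ n + (m + 2)) :
      (∏ i, ({g | WeightLE m GA (fun j => ω (j + 1)) p' (k i) g}.ncard : ℝ)) ≤
        C ^ (m + 2) * y ^ (n + (m + 2) + 1) := by
    calc _ ≤ ∏ i, C * y ^ k i := Finset.prod_le_prod (fun _ _ => by positivity) fun i _ => hcount _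
      _ = C ^ (m + 2) * y ^ ∑ i, k i := by
        rw [Finset.prod_mul_distrib, Finset.prod_pow_eq_pow_sum]
        simp
      _ ≤ _ := by
        gcongr ?_ * ?_
        exact pow_le_pow_right₀ hy1 (by omega)
  calc ({g | WeightLE m GA ω p n g}.ncard : ℝ)
      ≤ Nat.card GA * ∑ k ∈ (Fintype.piFinset fun _ : Fin (m + 2) =>
          Finset.range (n + (m + 2) + 1)).filter (fun k => ∑ y, k y ≤ n + (m + 2)),
          ∏ y, ({g | WeightLE m GA (fun j => ω (j + 1)) p' (k y) g}.ncard : ℝ) := by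
        exact_mod_cast ncard_weightLE_le_sum hω hp hp2 hp3 hpp n
    _ ≤ Nat.card GA * (((n + (m + 2) + 1 : ℕ) : ℝ) ^ (m + 2) *
          (C ^ (m + 2) * y ^ (n + (m + 2) + 1))) := by
        gcongr
        refine (Finset.sum_le_card_nsmul _ _ _ fun k hk =>
          hterm k (Finset.mem_filter.1 hk).2).trans ?_
        rw [nsmul_eq_mul]
        gcongr
        refine (Nat.cast_le.2 (Finset.card_filter_le _ _)).trans_eq ?_
        simp
    _ = Nat.card GA * (C ^ (m + 2) *
          (((n + (m + 2) + 1 : ℕ) : ℝ) ^ (m + 2) * y ^ (n + (m + 2) + 1))) := by ring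
    _ ≤ Nat.card GA * (C ^ (m + 2) * (K * z ^ (n + (m + 2) + 1))) := by
        gcongr ?_ * (?_ * ?_)
        exact hK' _
    _ = _ := by ring

/-- Descending until every letter has been killed once contracts the exponent by `2 / 3`. -/
theorem HasRate.contract {m : ℕ} {GA : Subgroup (Equiv.Perm (Fin (m + 2)))}
    {ω : ℕ → GB →* Equiv.Perm (Fin (m + 2))} (hω : ∀ j b, ω j b ∈ GA) {r : ℕ}
    (hr : ∀ b, ∃ i < r, ω i b = 1) {x : ℝ} (hx : 1 ≤ x)
    (h : HasRate m GA (fun j => ω (j + r)) (fun _ => 1) (x ^ 3)) :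
    HasRate m GA ω (fun _ => 1) (x ^ 2) := by
  classical
  let p : ℕ → GB → ℕ := fun j b => if ∃ i < j, ω i b = 1 then 3 else 2
  have hp2 (j b) : 2 ≤ p j b := by
    simp only [p]
    split_ifs <;> omega
  have hp3 (j b) : p j b ≤ 3 := by
    simp only [p]
    split_ifs <;> omega
  have hpr : p r = fun _ => 3 := funext fun b => if_pos (hr b)
  have hp0 : p 0 = fun _ => 2 := funext fun b => if_neg (by simp)
  have main (d : ℕ) (hd : d ≤ r) : HasRate m GA (fun j => ω (j + (r - d))) (p (r - d)) x := by
    induction d with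
    | zero =>
      rw [Nat.sub_zero, hpr]
      exact h.of_unit (by norm_num) hx
    | succ d ih =>
      obtain ⟨e, he, he'⟩ : ∃ e, r - (d + 1) = e ∧ r - d = e + 1 := ⟨_, rfl, by omega⟩
      have ih := ih (by omega)
      rw [he'] at ih
      rw [he]
      have hshift : (fun j => ω (j + 1 + e)) = fun j => ω (j + (e + 1)) :=
        funext fun j => by rw [add_assoc, add_comm 1 e]
      rw [← hshift] at ih
      refine HasRate.of_shift hx (fun b => hω _ b) (hp2 _) (hp2 (e + 1)) (hp3 (e + 1)) (fun b => ?_)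
        ih
      by_cases hb : ω e b = 1
      · left
        simpa using hb
      · right
        simp only [p]
        split_ifs with h1 h2
        · exact le_rfl
        · obtain ⟨i, hi, hib⟩ := h1
          rcases Nat.lt_succ_iff_lt_or_eq.1 hi with hlt | rfl
          · exact absurd ⟨i, hlt, hib⟩ h2
          · exact absurd hib hb
        · omega
        · exact le_rfl
  have h0 := main r le_rfl
  rw [Nat.sub_self, hp0] at h0
  exact h0.to_unit (by norm_num) (by linarith)

theorem exists_forall_kernel_lt {m : ℕ} {ω : ℕ → GB →* Equiv.Perm (Fin (m + 2))}
    (h : ∀ b, ∃ j, ω j b = 1) : ∃ r, ∀ b, ∃ i < r, ω i b = 1 := by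
  have := Fintype.ofFinite GB
  choose j hj using h
  exact ⟨Finset.univ.sup j + 1, fun b =>
    ⟨j b, Nat.lt_succ_of_le (Finset.le_sup (Finset.mem_univ b)), hj b⟩⟩

theorem hasRate_one_one {m : ℕ} {GA : Subgroup (Equiv.Perm (Fin (m + 2)))}
    {ω : ℕ → GB →* Equiv.Perm (Fin (m + 2))} (hω : ∀ j b, ω j b ∈ GA)
    (hcov : ∀ i b, ∃ j, i ≤ j ∧ ω j b = 1) : HasRate m GA ω (fun _ => 1) 1 := by
  set t : ℝ := Real.log (Nat.card GB * Nat.card GA)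
  have hpos : (0 : ℝ) < Nat.card GB * Nat.card GA := by
    have := Nat.card_pos (α := GB)
    have := Nat.card_pos (α := GA)
    positivity
  have ht : 0 ≤ t := by
    have := Nat.card_pos (α := GB)
    have := Nat.card_pos (α := GA)
    exact Real.log_nonneg (by exact_mod_cast Nat.mul_pos ‹_› ‹_›)
  have main (k : ℕ) : ∀ ω : ℕ → GB →* Equiv.Perm (Fin (m + 2)), (∀ j b, ω j b ∈ GA) →
      (∀ i b, ∃ j, i ≤ j ∧ ω j b = 1) →
      HasRate m GA ω (fun _ => 1) (Real.exp ((2 / 3) ^ k * t)) := by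
    induction k with
    | zero =>
      intro ω _ _
      rw [pow_zero, one_mul, Real.exp_log hpos]
      exact hasRate_one_card m GA ω
    | succ k ih =>
      intro ω hω hcov
      obtain ⟨r, hr⟩ := exists_forall_kernel_lt (ω := ω) fun b =>
        (hcov 0 b).imp fun _ => And.right
      have h1 := ih (fun j => ω (j + r)) (fun j b => hω _ b) fun i b => by
        obtain ⟨j, hj, hjb⟩ := hcov (i + r) b
        exact ⟨j - r, by omega, by rwa [Nat.sub_add_cancel (by omega)]⟩
      have h2 := HasRate.contract hω hr (x := Real.exp ((2 / 3) ^ k * t / 3))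
        (Real.one_le_exp (by positivity)) (by
          rw [← Real.exp_nat_mul]
          convert h1 using 2
          push_cast
          ring)
      rw [← Real.exp_nat_mul] at h2
      convert h2 using 2
      push_cast
      ring
  intro y hy
  have hlim : Tendsto (fun k : ℕ => Real.exp ((2 / 3) ^ k * t)) atTop (𝓝 1) := by
    have := (tendsto_pow_atTop_nhds_zero_of_lt_one (r := (2 / 3 : ℝ)) (by norm_num)
      (by norm_num)).mul_const t
    rw [zero_mul] at this
    simpa [Function.comp_def] using (Real.continuous_exp.tendsto 0).comp this
  obtain ⟨k, hk⟩ := (hlim.eventually_lt_const hy).exists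
  exact main k ω hω hcov y hk

end Counting

/-! ### Word length -/

theorem inv_mem_genSet {m : ℕ} {GA : Subgroup (Equiv.Perm (Fin (m + 2)))}
    {ω : ℕ → GB →* Equiv.Perm (Fin (m + 2))} {g : Equiv.Perm (List (Fin (m + 2)))}
    (hg : g ∈ genSet m GA ω) : g⁻¹ ∈ genSet m GA ω := by
  obtain ⟨⟨a, ha, rfl⟩ | ⟨b, rfl⟩, h1⟩ := hg
  · exact ⟨Or.inl ⟨a⁻¹, GA.inv_mem ha, rootAut_inv m a⟩, by simpa using h1⟩
  · exact ⟨Or.inr ⟨b⁻¹, spinalAut_inv m ω b⟩, by simpa using h1⟩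

theorem WeightLE.mul_list_prod {m : ℕ} {GA : Subgroup (Equiv.Perm (Fin (m + 2)))}
    {ω : ℕ → GB →* Equiv.Perm (Fin (m + 2))} {n : ℕ} {g : Equiv.Perm (List (Fin (m + 2)))}
    (h : WeightLE m GA ω (fun _ => 1) n g) (l : List (Equiv.Perm (List (Fin (m + 2)))))
    (hl : ∀ x ∈ l, x ∈ genSet m GA ω) :
    WeightLE m GA ω (fun _ => 1) (n + l.length) (g * l.prod) := by
  induction l generalizing n g with
  | nil => simpa using h
  | cons x l ih =>
    rw [List.prod_cons, ← mul_assoc, List.length_cons, add_comm l.length, ← add_assoc]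
    refine ih ?_ fun y hy => hl y (List.mem_cons_of_mem _ hy)
    obtain ⟨⟨a, ha, rfl⟩ | ⟨b, rfl⟩, -⟩ := hl x List.mem_cons_self
    · exact (h.mul_root ha).mono n.le_succ
    · exact h.mul_spinal b

theorem weightLE_of_wordLength_le {m : ℕ} {GA : Subgroup (Equiv.Perm (Fin (m + 2)))}
    {ω : ℕ → GB →* Equiv.Perm (Fin (m + 2))} {n : ℕ} {g : Equiv.Perm (List (Fin (m + 2)))}
    (hg : g ∈ spinalGroup m GA ω) (hn : wordLength (genSet m GA ω) g ≤ n) :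
    WeightLE m GA ω (fun _ => 1) n g := by
  have hne : {k | ∃ l : List (Equiv.Perm (List (Fin (m + 2)))), l.length = k ∧
      (∀ x ∈ l, x ∈ genSet m GA ω) ∧ l.prod = g}.Nonempty := by
    rw [spinalGroup, ← Subgroup.mem_toSubmonoid, Subgroup.closure_toSubmonoid] at hg
    obtain ⟨l, hl, hprod⟩ := Submonoid.exists_list_of_mem_closure hg
    refine ⟨_, l, rfl, fun x hx => (hl x hx).elim id fun h => ?_, hprod⟩
    simpa using inv_mem_genSet (Set.mem_inv.1 h)
  obtain ⟨l, hlen, hl, rfl⟩ := Nat.sInf_mem hne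
  have h := (WeightLE.one (p := fun _ : GB => 1) 0).mul_list_prod l hl
  rw [zero_add, one_mul] at h
  exact h.mono (hlen.trans_le hn)

theorem one_le_growth [Finite GB] (m : ℕ) (GA : Subgroup (Equiv.Perm (Fin (m + 2))))
    (ω : ℕ → GB →* Equiv.Perm (Fin (m + 2))) (n : ℕ) : 1 ≤ growth m GA ω n := by
  have : Finite {g // g ∈ spinalGroup m GA ω ∧ wordLength (genSet m GA ω) g ≤ n} :=
    (finite_weightLE GA ω (fun _ => le_rfl) n).subset fun g hg =>
      weightLE_of_wordLength_le hg.1 hg.2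
  have h1 : wordLength (genSet m GA ω) 1 ≤ n := by
    refine le_trans ?_ n.zero_le
    exact Nat.sInf_le ⟨[], rfl, by simp, rfl⟩
  have : Nonempty {g // g ∈ spinalGroup m GA ω ∧ wordLength (genSet m GA ω) g ≤ n} :=
    ⟨1, one_mem _, h1⟩
  exact Nat.card_pos

theorem growth_le_ncard_weightLE [Finite GB] (m : ℕ)
    (GA : Subgroup (Equiv.Perm (Fin (m + 2)))) (ω : ℕ → GB →* Equiv.Perm (Fin (m + 2))) (n : ℕ) :
    growth m GA ω n ≤ {g | WeightLE m GA ω (fun _ => 1) n g}.ncard :=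
  Set.ncard_le_ncard (s := {g | g ∈ spinalGroup m GA ω ∧ wordLength (genSet m GA ω) g ≤ n})
    (fun _ hg => weightLE_of_wordLength_le hg.1 hg.2) (finite_weightLE GA ω (fun _ => le_rfl) n)

open Filter Topology in
theorem tendsto_rpow_inv_of_subexponential {f : ℕ → ℝ} (h1 : ∀ n, 1 ≤ f n)
    (h : ∀ y : ℝ, 1 < y → ∃ C : ℝ, ∀ n, f n ≤ C * y ^ n) :
    Tendsto (fun n : ℕ => f n ^ (n : ℝ)⁻¹) atTop (𝓝 1) := by
  refine tendsto_order.2 ⟨fun a ha => Eventually.of_forall fun n =>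
    ha.trans_le (Real.one_le_rpow (h1 n) (by positivity)), fun a ha => ?_⟩
  obtain ⟨y, hy, hya⟩ := exists_between ha
  obtain ⟨C, hC⟩ := h y hy
  have hC1 : 1 ≤ C := by simpa using (h1 0).trans (hC 0)
  have hlim : Tendsto (fun n : ℕ => C ^ (n : ℝ)⁻¹ * y) atTop (𝓝 y) := by
    have hinv := tendsto_inv_atTop_zero.comp (tendsto_natCast_atTop_atTop (R := ℝ))
    have := ((tendsto_const_nhds (x := C)).rpow hinv (Or.inl (by positivity))).mul_const y
    simpa using this
  filter_upwards [hlim.eventually_lt_const hya, eventually_ne_atTop 0] with n hn hn0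
  refine lt_of_le_of_lt ?_ hn
  have hy0 : 0 ≤ y := by linarith
  calc f n ^ (n : ℝ)⁻¹ ≤ (C * y ^ n) ^ (n : ℝ)⁻¹ :=
        Real.rpow_le_rpow (by linarith [h1 n]) (hC n) (by positivity)
    _ = C ^ (n : ℝ)⁻¹ * y := by
        rw [Real.mul_rpow (by linarith) (by positivity), Real.pow_rpow_inv_natCast hy0 hn0]

/-- For every `ω ∈ Ω̂` the spinal group `G_ω` has subexponential word growth:
`limsup_{n→∞} γ_ω(n)^{1/n} = 1`. -/
theorem spinalGroup_subexponential_growth (m : ℕ)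
    (GA : Subgroup (Equiv.Perm (Fin (m + 2))))
    {GB : Type*} [Group GB] [Finite GB] (ω : ℕ → GB →* Equiv.Perm (Fin (m + 2)))
    (hdata : SpinalData m GA ω) :
    Filter.limsup (fun n : ℕ => (growth m GA ω n : ℝ) ^ ((n : ℝ)⁻¹)) Filter.atTop = 1 := by
  refine (tendsto_rpow_inv_of_subexponential (f := fun n => (growth m GA ω n : ℝ))
    (fun n => by exact_mod_cast one_le_growth m GA ω n) fun y hy => ?_).limsup_eq
  obtain ⟨C, -, hC⟩ := hasRate_one_one (GA := GA) (ω := ω)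
    (fun j b => hdata.range_eq j ▸ ⟨b, rfl⟩) hdata.kernels_cover y hy
  exact ⟨C, fun n => (Nat.cast_le.2 (growth_le_ncard_weightLE m GA ω n)).trans (hC n)⟩

end Spinal
end
end
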